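/- Let φ₀ be a Banach–Minkowski norm on ℝ² that is nowhere locally Euclidean: there is no nonempty open set W ⊆ ℝ²∖{0} and positive definite quadratic form q on ℝ² with φ₀(v)² = q(v) for all v ∈ W. Define φ : ℝ² × ℝ² → ℝ by φ((x, y), (ξ, η)) := φ₀(ξ·cos y − η·sin y, ξ·sin y + η·cos y). Then φ is a Finsler metric on ℝ², and for every nonempty open set U ⊆ ℝ², every 3-dimensional real vector space V with Banach–Minkowski norm Φ, there is no C^∞ injective map f : U → V with Φ(Df_{(x,y)}(ξ, η)) = φ((x, y), (ξ, η)) for all (x, y) ∈ U and (ξ, η) ∈ ℝ². That is, no open subset of (ℝ², φ) admits a smooth isometric embedding into a 3-dimensional Banach–Minkowski space. -/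

import Mathlib

noncomputable section

def IsBanachMinkowski {V : Type*} [NormedAddCommGroup V] [NormedSpace ℝ V] (Φ : V → ℝ) : Prop :=
  Φ 0 = 0 ∧
  (∀ v : V, v ≠ 0 → 0 < Φ v) ∧
  (∀ t : ℝ, 0 ≤ t → ∀ v : V, Φ (t • v) = t * Φ v) ∧
  (∀ v w : V, Φ (v + w) ≤ Φ v + Φ w) ∧
  ContDiffOn ℝ (⊤ : ℕ∞) Φ {(0 : V)}ᶜ ∧
  (∀ v : V, v ≠ 0 → ∀ w : V, w ≠ 0 →
    0 < iteratedFDeriv ℝ 2 (fun u => Φ u ^ 2) v ![w, w])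

def IsFinslerMetric (U : Set (ℝ × ℝ)) (φ : ℝ × ℝ → ℝ × ℝ → ℝ) : Prop :=
  ContDiffOn ℝ (⊤ : ℕ∞) (fun q : (ℝ × ℝ) × ℝ × ℝ => φ q.1 q.2) (U ×ˢ {(0 : ℝ × ℝ)}ᶜ) ∧
  ∀ x ∈ U, IsBanachMinkowski (φ x)

namespace BM
variable {V : Type*} [NormedAddCommGroup V] [NormedSpace ℝ V] {Φ : V → ℝ}

lemma smooth (h : IsBanachMinkowski Φ) {v : V} (hv : v ≠ 0) :
    ContDiffAt ℝ (⊤ : ℕ∞) (fun u => Φ u ^ 2) v :=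
  ((h.2.2.2.2.1).contDiffAt (isOpen_compl_singleton.mem_nhds hv)).pow 2

lemma diff (h : IsBanachMinkowski Φ) {v : V} (hv : v ≠ 0) :
    HasFDerivAt (fun u => Φ u ^ 2) (fderiv ℝ (fun u => Φ u ^ 2) v) v :=
  ((smooth h hv).differentiableAt (by simp)).hasFDerivAt

lemma diff2 (h : IsBanachMinkowski Φ) {v : V} (hv : v ≠ 0) :
    HasFDerivAt (fderiv ℝ (fun u => Φ u ^ 2)) (fderiv ℝ (fderiv ℝ (fun u => Φ u ^ 2)) v) v :=
  (((smooth h hv).fderiv_right (m := (⊤ : ℕ∞)) le_rfl).differentiableAt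
    (by simp)).hasFDerivAt

lemma sqpos (h : IsBanachMinkowski Φ) {v : V} (hv : v ≠ 0) : 0 < Φ v ^ 2 :=
  pow_pos (h.2.1 v hv) 2

lemma hom (h : IsBanachMinkowski Φ) (v : V) {t : ℝ} (ht : 0 ≤ t) :
    Φ (t • v) ^ 2 = t ^ 2 * Φ v ^ 2 := by
  rw [h.2.2.1 t ht v]; ring

lemma euler (h : IsBanachMinkowski Φ) {v : V} (hv : v ≠ 0) :
    fderiv ℝ (fun u => Φ u ^ 2) v v = 2 * Φ v ^ 2 := by
  have hc : HasDerivAt (fun t : ℝ => t • v) v 1 := by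
    simpa using (hasDerivAt_id (1:ℝ)).smul_const v
  have h1 : HasDerivAt (fun t : ℝ => Φ (t • v) ^ 2) (fderiv ℝ (fun u => Φ u ^ 2) v v) 1 := by
    have := (show HasFDerivAt (fun u => Φ u ^ 2) (fderiv ℝ (fun u => Φ u ^ 2) v) ((1:ℝ) • v) by
      simpa using diff h hv).comp_hasDerivAt (1:ℝ) hc
    exact this
  have h2 : HasDerivAt (fun t : ℝ => t ^ 2 * Φ v ^ 2) (2 * Φ v ^ 2) 1 := by
    simpa using ((hasDerivAt_id (1:ℝ)).pow 2).mul_const (Φ v ^ 2)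
  refine h1.unique (h2.congr_of_eventuallyEq ?_)
  filter_upwards [lt_mem_nhds (show (0:ℝ) < 1 by norm_num)] with t ht
  exact hom h v ht.le

lemma dhom (h : IsBanachMinkowski Φ) {v : V} (hv : v ≠ 0) {t : ℝ} (ht : 0 < t) :
    fderiv ℝ (fun u => Φ u ^ 2) (t • v) = t • fderiv ℝ (fun u => Φ u ^ 2) v := by
  have h1 : HasFDerivAt (fun w => Φ (t • w) ^ 2)
      ((fderiv ℝ (fun u => Φ u ^ 2) (t • v)).comp (t • ContinuousLinearMap.id ℝ V)) v :=
    (diff h (smul_ne_zero ht.ne' hv)).comp v ((hasFDerivAt_id v).const_smul t)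
  have h2 : HasFDerivAt (fun w => Φ (t • w) ^ 2)
      (t ^ 2 • fderiv ℝ (fun u => Φ u ^ 2) v) v := by
    have := (diff h hv).const_mul (t^2)
    refine this.congr_of_eventuallyEq (Filter.Eventually.of_forall fun w => ?_)
    exact hom h w ht.le
  have := h1.unique h2
  ext w
  have := DFunLike.congr_fun this w
  simp at this ⊢
  have h3 : t * (fderiv ℝ (fun u => Φ u ^ 2) (t • v) w) =
    t * (t * fderiv ℝ (fun u => Φ u ^ 2) v w) := by rw [this]; ring
  exact mul_left_cancel₀ ht.ne' h3

lemma euler2 (h : IsBanachMinkowski Φ) {v : V} (hv : v ≠ 0) :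
    fderiv ℝ (fderiv ℝ (fun u => Φ u ^ 2)) v v = fderiv ℝ (fun u => Φ u ^ 2) v := by
  have hc : HasDerivAt (fun t : ℝ => t • v) v 1 := by
    simpa using (hasDerivAt_id (1:ℝ)).smul_const v
  have h1 : HasDerivAt (fun t : ℝ => fderiv ℝ (fun u => Φ u ^ 2) (t • v))
      (fderiv ℝ (fderiv ℝ (fun u => Φ u ^ 2)) v v) 1 := by
    exact (show HasFDerivAt (fderiv ℝ (fun u => Φ u ^ 2))
      (fderiv ℝ (fderiv ℝ (fun u => Φ u ^ 2)) v) ((1:ℝ) • v) by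
      simpa using diff2 h hv).comp_hasDerivAt (1:ℝ) hc
  have h2 : HasDerivAt (fun t : ℝ => t • fderiv ℝ (fun u => Φ u ^ 2) v)
      (fderiv ℝ (fun u => Φ u ^ 2) v) 1 := by
    simpa using (hasDerivAt_id (1:ℝ)).smul_const (fderiv ℝ (fun u => Φ u ^ 2) v)
  refine h1.unique (h2.congr_of_eventuallyEq ?_)
  filter_upwards [lt_mem_nhds (show (0:ℝ) < 1 by norm_num)] with t ht
  exact dhom h hv ht

lemma posdef (h : IsBanachMinkowski Φ) {v : V} (hv : v ≠ 0) {w : V} (hw : w ≠ 0) :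
    0 < fderiv ℝ (fderiv ℝ (fun u => Φ u ^ 2)) v w w := by
  have := h.2.2.2.2.2 v hv w hw
  rw [iteratedFDeriv_two_apply] at this
  simpa using this

lemma eig (h : IsBanachMinkowski Φ) {v : V} (hv : v ≠ 0) {μ : ℝ}
    (h0 : fderiv ℝ (fun u => Φ u ^ 2) v (μ • v) = 0) : μ = 0 := by
  rw [map_smul, euler h hv, smul_eq_mul] at h0
  have := sqpos h hv
  rcases mul_eq_zero.1 h0 with h | h
  · exact h
  · linarith

lemma comp_equiv (h : IsBanachMinkowski Φ) {W : Type*} [NormedAddCommGroup W] [NormedSpace ℝ W]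
    (e : W ≃L[ℝ] V) : IsBanachMinkowski (fun w => Φ (e w)) := by
  obtain ⟨h0, h1, h2, h3, h4, h5⟩ := id h
  refine ⟨by simp [h0], fun v hv => h1 _ (by simpa using hv), fun t ht v => ?_, fun v w => ?_, ?_, ?_⟩
  · simp [h2 t ht]
  · simpa using h3 (e v) (e w)
  · exact h4.comp e.contDiff.contDiffOn (fun v hv => by simpa using hv)
  · intro v hv w hw
    have hv' : e v ≠ 0 := by simpa using hv
    have hw' : e w ≠ 0 := by simpa using hw
    have := e.iteratedFDerivWithin_comp_right (fun u => Φ u ^ 2) uniqueDiffOn_univ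
      (x := v) (by simp) 2
    simp only [Set.preimage_univ, iteratedFDerivWithin_univ] at this
    have h6 := DFunLike.congr_fun this ![w, w]
    have h7 : iteratedFDeriv ℝ 2 (fun u => Φ (e u) ^ 2) v ![w, w] =
      iteratedFDeriv ℝ 2 (fun u => Φ u ^ 2) (e v) ![e w, e w] := by
      rw [iteratedFDeriv_two_apply] at h6 ⊢
      rw [iteratedFDeriv_two_apply]
      simpa [Function.comp_def, iteratedFDeriv_two_apply] using h6
    rw [h7]
    exact h5 _ hv' _ hw'

end BM

def NowhereEuc (φ₀ : ℝ × ℝ → ℝ) : Prop :=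
  ∀ W : Set (ℝ × ℝ), IsOpen W → W.Nonempty → W ⊆ {(0 : ℝ × ℝ)}ᶜ →
      ∀ q : QuadraticForm ℝ (ℝ × ℝ), q.PosDef → ¬ (∀ v ∈ W, φ₀ v ^ 2 = q v)

lemma exists_qf (a b c : ℝ) : ∃ q : QuadraticForm ℝ (ℝ × ℝ),
    ∀ v, q v = a * v.1 ^ 2 + b * (v.1 * v.2) + c * v.2 ^ 2 := by
  let F := LinearMap.fst ℝ ℝ ℝ
  let S := LinearMap.snd ℝ ℝ ℝ
  refine ⟨a • QuadraticMap.linMulLin F F + b • QuadraticMap.linMulLin F S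
    + c • QuadraticMap.linMulLin S S, fun v => ?_⟩
  simp [F, S, QuadraticMap.linMulLin_apply]
  ring

lemma par (v u : ℝ × ℝ) (hv : v ≠ 0) (h : v.1 * u.2 - v.2 * u.1 = 0) : ∃ μ : ℝ, u = μ • v := by
  by_cases h1 : v.1 = 0
  · have h2 : v.2 ≠ 0 := fun h2 => hv (Prod.ext h1 h2)
    refine ⟨u.2 / v.2, Prod.ext ?_ ?_⟩
    · have : u.1 = 0 := by
        rw [h1] at h
        have : v.2 * u.1 = 0 := by linarith
        exact (mul_eq_zero.1 this).resolve_left h2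
      simp [h1, this]
    · simp; field_simp
  · refine ⟨u.1 / v.1, Prod.ext ?_ ?_⟩
    · simp; field_simp
    · simp; field_simp; linarith

lemma span2 (v u x : ℝ × ℝ) (h : v.1 * u.2 - v.2 * u.1 ≠ 0) : ∃ s t : ℝ, x = s • v + t • u := by
  refine ⟨(x.1 * u.2 - x.2 * u.1) / (v.1 * u.2 - v.2 * u.1),
    (v.1 * x.2 - v.2 * x.1) / (v.1 * u.2 - v.2 * u.1), Prod.ext ?_ ?_⟩
  · simp only [Prod.fst_add, Prod.smul_fst, smul_eq_mul]
    rw [div_mul_eq_mul_div, div_mul_eq_mul_div, ← add_div, eq_div_iff h]; ring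
  · simp only [Prod.snd_add, Prod.smul_snd, smul_eq_mul]
    rw [div_mul_eq_mul_div, div_mul_eq_mul_div, ← add_div, eq_div_iff h]; ring

lemma perp_det (v : ℝ × ℝ) (hv : v ≠ 0) :
    v.1 * ((-v.2, v.1) : ℝ × ℝ).2 - v.2 * ((-v.2, v.1) : ℝ × ℝ).1 ≠ 0 := by
  simp only
  intro h
  apply hv
  have h1 : v.1 = 0 := by nlinarith [sq_nonneg v.1, sq_nonneg v.2]
  have h2 : v.2 = 0 := by nlinarith [sq_nonneg v.1, sq_nonneg v.2]
  exact Prod.ext h1 h2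

lemma comb_ne (v u : ℝ × ℝ) (h : v.1 * u.2 - v.2 * u.1 ≠ 0) (s t : ℝ) (ht : s ≠ 0 ∨ t ≠ 0) :
    s • v + t • u ≠ 0 := by
  intro h0
  have h1 := congrArg Prod.fst h0
  have h2 := congrArg Prod.snd h0
  simp at h1 h2
  have e1 : s * (v.1 * u.2 - v.2 * u.1) = 0 := by linear_combination u.2 * h1 - u.1 * h2
  have e2 : t * (v.1 * u.2 - v.2 * u.1) = 0 := by linear_combination v.1 * h2 - v.2 * h1
  rcases ht with ht | ht
  · exact (mul_ne_zero ht h) e1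
  · exact (mul_ne_zero ht h) e2

/-- density: a linear field tangent off a line is tangent everywhere. -/
lemma dens {φ₀ : ℝ × ℝ → ℝ} (h : IsBanachMinkowski φ₀) (v u : ℝ × ℝ) (hv : v ≠ 0)
    (M : ℝ × ℝ →L[ℝ] ℝ × ℝ)
    (hM : ∀ t : ℝ, t ≠ 0 → fderiv ℝ (fun u => φ₀ u ^ 2) (v + t • u) (M (v + t • u)) = 0) :
    fderiv ℝ (fun u => φ₀ u ^ 2) v (M v) = 0 := by
  have hc : ContinuousAt (fun x => fderiv ℝ (fun u => φ₀ u ^ 2) x (M x)) v :=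
    (BM.diff2 h hv).continuousAt.clm_apply M.continuous.continuousAt
  have hl : Filter.Tendsto (fun t : ℝ => v + t • u) (nhdsWithin 0 {0}ᶜ) (nhds v) := by
    have : Continuous (fun t : ℝ => v + t • u) := by fun_prop
    have := this.tendsto 0
    simp at this
    exact this.mono_left nhdsWithin_le_nhds
  have h1 := hc.tendsto.comp hl
  refine tendsto_nhds_unique h1 (tendsto_const_nhds.congr' ?_)
  filter_upwards [self_mem_nhdsWithin] with t ht
  exact (hM t ht).symm

lemma L1 {φ₀ : ℝ × ℝ → ℝ} (h : IsBanachMinkowski φ₀) (hn : NowhereEuc φ₀)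
    (M : ℝ × ℝ →L[ℝ] ℝ × ℝ)
    (hM : ∀ v, v ≠ 0 → fderiv ℝ (fun u => φ₀ u ^ 2) v (M v) = 0) : M = 0 := by
  by_cases hq : ∃ v : ℝ × ℝ, v ≠ 0 ∧ v.1 * (M v).2 - v.2 * (M v).1 = 0
  · obtain ⟨v, hv, hq⟩ := hq
    have hMv : M v = 0 := by
      obtain ⟨μ, hμ⟩ := par v (M v) hv hq
      have h1 := hM v hv
      rw [hμ] at h1
      rw [hμ, BM.eig h hv h1, zero_smul]
    set u : ℝ × ℝ := (-v.2, v.1) with hu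
    have hd := perp_det v hv
    rw [← hu] at hd
    obtain ⟨a, b, hab⟩ := span2 v u (M u) hd
    have hb : b = 0 := by
      by_contra hb
      have hne := comb_ne v u hd a b (Or.inr hb)
      apply hb
      apply BM.eig h hne
      have h1 := hM _ hne
      rwa [map_add, map_smul, map_smul, hMv, smul_zero, zero_add, hab] at h1
    rw [hb, zero_smul, add_zero] at hab
    have ha : a = 0 := by
      apply BM.eig h hv
      let N : ℝ × ℝ →L[ℝ] ℝ × ℝ := a • ContinuousLinearMap.id ℝ (ℝ × ℝ)
      have hc : ContinuousAt (fun x => fderiv ℝ (fun u => φ₀ u ^ 2) x (a • v)) v :=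
        (BM.diff2 h hv).continuousAt.clm_apply continuousAt_const
      have hl : Filter.Tendsto (fun t : ℝ => v + t • u) (nhdsWithin 0 {0}ᶜ) (nhds v) := by
        have : Continuous (fun t : ℝ => v + t • u) := by fun_prop
        have := this.tendsto 0
        simp at this
        exact this.mono_left nhdsWithin_le_nhds
      have h1 := hc.tendsto.comp hl
      refine tendsto_nhds_unique h1 (tendsto_const_nhds.congr' ?_)
      filter_upwards [self_mem_nhdsWithin] with t ht
      have hne := comb_ne v u hd 1 t (Or.inr ht)
      rw [one_smul] at hne
      have h2 := hM _ hne
      rw [map_add, map_smul, hMv, zero_add, hab, map_smul, smul_eq_mul] at h2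
      exact ((mul_eq_zero.1 h2).resolve_left ht).symm
    rw [ha, zero_smul] at hab
    refine ContinuousLinearMap.ext fun x => ?_
    obtain ⟨s, t, rfl⟩ := span2 v u x hd
    simp [hMv, hab]
  · push Not at hq
    exfalso
    set g : ℝ × ℝ → ℝ := fun u => φ₀ u ^ 2 with hg
    set a := (M (1,0)).1 with ha
    set b := (M (0,1)).1 with hb
    set c := (M (1,0)).2 with hc
    set d := (M (0,1)).2 with hd
    have hMe : ∀ v, M v = (v.1 * a + v.2 * b, v.1 * c + v.2 * d) := by
      intro v
      have : v = v.1 • ((1,0) : ℝ × ℝ) + v.2 • ((0,1) : ℝ × ℝ) := by ext <;> simp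
      conv_lhs => rw [this]
      rw [map_add, map_smul, map_smul]
      ext <;> simp [ha, hb, hc, hd]
    set q : ℝ × ℝ → ℝ := fun v => c * v.1 ^ 2 + (d - a) * (v.1 * v.2) + (-b) * v.2 ^ 2 with hqd
    have hq0 : ∀ v, v ≠ 0 → q v ≠ 0 := by
      intro v hv h0
      apply hq v hv
      rw [hMe, ← h0, hqd]; simp only; ring
    let dq : ℝ × ℝ → (ℝ × ℝ →L[ℝ] ℝ) := fun v =>
      (2 * c * v.1 + (d - a) * v.2) • ContinuousLinearMap.fst ℝ ℝ ℝ
      + ((d - a) * v.1 - 2 * b * v.2) • ContinuousLinearMap.snd ℝ ℝ ℝ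
    have hdq : ∀ v, HasFDerivAt q (dq v) v := by
      intro v
      have h1 : HasFDerivAt (fun v : ℝ × ℝ => v.1) (ContinuousLinearMap.fst ℝ ℝ ℝ) v := hasFDerivAt_fst
      have h2 : HasFDerivAt (fun v : ℝ × ℝ => v.2) (ContinuousLinearMap.snd ℝ ℝ ℝ) v := hasFDerivAt_snd
      have := (((h1.pow 2).const_mul c).add ((h1.mul h2).const_mul (d-a))).add ((h2.pow 2).const_mul (-b))
      refine this.congr_fderiv ?_
      ext <;> simp [dq] <;> ring
    have hgpos : ∀ v, v ≠ 0 → 0 < g v := fun v hv => BM.sqpos h hv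
    set ρ : ℝ × ℝ → ℝ := fun v => q v / g v with hρ
    have hdρ : ∀ v, v ≠ 0 → HasFDerivAt ρ ((g v ^ 2)⁻¹ • (g v • dq v - q v • fderiv ℝ g v)) v := by
      intro v hv
      have hgv := (hgpos v hv).ne'
      have h1 := (hdq v).mul ((hasDerivAt_inv hgv).comp_hasFDerivAt v (BM.diff h hv))
      refine (h1.congr_fderiv ?_).congr_of_eventuallyEq
        (Filter.Eventually.of_forall fun x => div_eq_mul_inv _ _)
      change φ₀ v ^ 2 ≠ 0 at hgv
      ext <;> simp [hg] <;> field_simp <;> ring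
    have hρhom : ∀ v, v ≠ 0 → ∀ t : ℝ, 0 < t → ρ (t • v) = ρ v := by
      intro v hv t ht
      have e1 : g (t • v) = t ^ 2 * g v := BM.hom h v ht.le
      have e2 : q (t • v) = t ^ 2 * q v := by simp [hqd]; ring
      simp only [hρ]
      rw [e1, e2, mul_div_mul_left _ _ (pow_pos ht 2).ne']
    have hsph : (Metric.sphere (0 : ℝ × ℝ) 1).Nonempty := ⟨(1,0), by simp [Prod.norm_def]⟩
    have hsne : ∀ v ∈ Metric.sphere (0 : ℝ × ℝ) 1, v ≠ 0 := by
      intro v hv h0; simp [h0] at hv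
    obtain ⟨v0, hv0, hmax⟩ := (isCompact_sphere (0 : ℝ × ℝ) 1).exists_isMaxOn hsph
      (f := ρ) (fun v hv => (hdρ v (hsne v hv)).continuousAt.continuousWithinAt)
    have hv0' := hsne v0 hv0
    have hloc : IsLocalMax ρ v0 := by
      filter_upwards [isOpen_compl_singleton.mem_nhds hv0'] with v hv
      have hn : 0 < ‖v‖ := norm_pos_iff.2 hv
      have h1 : (‖v‖⁻¹ • v) ∈ Metric.sphere (0 : ℝ × ℝ) 1 := by
        simp [norm_smul, hn.ne']
      have h2 := hmax h1
      simp only [Set.mem_ofPred_eq] at h2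
      rwa [hρhom v hv _ (inv_pos.2 hn)] at h2
    have hz := hloc.hasFDerivAt_eq_zero (hdρ v0 hv0')
    have hdqM : ∀ v, dq v (M v) = (a + d) * q v := by
      intro v; rw [hMe]; simp [dq, hqd]; ring
    have hdqE : ∀ v, dq v v = 2 * q v := by
      intro v; simp [dq, hqd]; ring
    have htr : a + d = 0 := by
      have h1 := DFunLike.congr_fun hz (M v0)
      have h2 := hM v0 hv0'
      simp [hdqM, h2, (hgpos v0 hv0').ne', hq0 v0 hv0'] at h1
      exact h1
    have hd0 : ∀ v, v ≠ 0 → fderiv ℝ ρ v = 0 := by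
      intro v hv
      rw [(hdρ v hv).fderiv]
      have hne : v.1 * (M v).2 - v.2 * (M v).1 ≠ 0 := hq v hv
      have e1 : dq v (M v) = 0 := by rw [hdqM, htr, zero_mul]
      have e2 := hM v hv
      have e3 : fderiv ℝ g v v = 2 * g v := BM.euler h hv
      have e4 := hdqE v
      have key : ∀ x, (g v • dq v - q v • fderiv ℝ g v) x = 0 := by
        intro x
        obtain ⟨s, t, rfl⟩ := span2 v (M v) x hne
        simp only [sub_apply, smul_apply, map_add, map_smul,
          e1, e2, e3, e4, smul_eq_mul]
        ring
      ext1 <;> ext1 <;> simp only [ContinuousLinearMap.comp_apply, smul_apply, key] <;> simp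
    have hconn : IsPreconnected ({(0 : ℝ × ℝ)}ᶜ) := by
      refine (isConnected_compl_singleton_of_one_lt_rank ?_ 0).isPreconnected
      rw [← Module.finrank_eq_rank]; simp
    have h10 : ((1,0) : ℝ × ℝ) ≠ 0 := by simp
    have hconst : ∀ v, v ≠ 0 → ρ v = ρ (1,0) := by
      intro v hv
      exact isOpen_compl_singleton.is_const_of_fderiv_eq_zero hconn
        (fun v hv => (hdρ v hv).differentiableAt.differentiableWithinAt)
        (fun v hv => hd0 v hv) hv h10
    set κ := ρ (1,0) with hκ
    have hκ0 : κ ≠ 0 := div_ne_zero (hq0 _ h10) (hgpos _ h10).ne'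
    obtain ⟨qq, hqq⟩ := exists_qf (c / κ) ((d - a) / κ) (-b / κ)
    have hqg : ∀ v, v ≠ 0 → g v = qq v := by
      intro v hv
      have h1 := hconst v hv
      simp only [hρ] at h1
      rw [div_eq_iff (hgpos v hv).ne'] at h1
      rw [hqq]
      simp only [hqd] at h1
      field_simp
      linarith
    exact hn {0}ᶜ isOpen_compl_singleton ⟨(1,0), h10⟩ subset_rfl qq
      (fun v hv => by rw [← hqg v hv]; exact hgpos v hv) hqg

lemma L2 {φ₀ : ℝ × ℝ → ℝ} (h : IsBanachMinkowski φ₀) (hn : NowhereEuc φ₀)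
    (X Y : ℝ × ℝ →L[ℝ] ℝ × ℝ) (α β : ℝ × ℝ →L[ℝ] ℝ)
    (hQ : ∀ v, v ≠ 0 → fderiv ℝ (fun u => φ₀ u ^ 2) v (β v • X v - α v • Y v) = 0) :
    ∀ v, β v • X v = α v • Y v := by
  obtain ⟨v, hv, hq⟩ : ∃ v : ℝ × ℝ, v ≠ 0 ∧
      v.1 * (β v • X v - α v • Y v).2 - v.2 * (β v • X v - α v • Y v).1 = 0 := by
    let F : ℝ × ℝ → ℝ := fun v => v.1 * (β v • X v - α v • Y v).2 - v.2 * (β v • X v - α v • Y v).1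
    have hF : Continuous F := by fun_prop
    have hodd : ∀ v, F (-v) = - F v := by
      intro v; simp [F]; ring
    let k : ℝ → ℝ := fun s => F (Real.cos s, Real.sin s)
    have hk : Continuous k := by fun_prop
    have hk1 : k Real.pi = - k 0 := by
      simp only [k]; rw [← hodd]; simp
    have : ∃ s, k s = 0 := by
      rcases le_total 0 (k 0) with h0 | h0
      · exact mem_range_of_exists_le_of_exists_ge hk ⟨Real.pi, by linarith⟩ ⟨0, h0⟩
      · exact mem_range_of_exists_le_of_exists_ge hk ⟨0, h0⟩ ⟨Real.pi, by linarith⟩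
    obtain ⟨s, hs⟩ := this
    refine ⟨(Real.cos s, Real.sin s), ?_, hs⟩
    intro h0
    have h1 := congrArg Prod.fst h0
    have h2 := congrArg Prod.snd h0
    simp only [Prod.fst_zero, Prod.snd_zero] at h1 h2
    have := Real.sin_sq_add_cos_sq s
    rw [h1, h2] at this; norm_num at this
  have hQv : β v • X v - α v • Y v = 0 := by
    obtain ⟨μ, hμ⟩ := par v _ hv hq
    have h1 := hQ v hv
    rw [hμ] at h1
    rw [hμ, BM.eig h hv h1, zero_smul]
  set u : ℝ × ℝ := (-v.2, v.1) with hu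
  have hd := perp_det v hv
  rw [← hu] at hd
  set D := v.1 * u.2 - v.2 * u.1 with hD
  set B : ℝ × ℝ := β v • X u + β u • X v - (α v • Y u + α u • Y v) with hB
  set C : ℝ × ℝ := β u • X u - α u • Y u with hC
  have hQst : ∀ s t : ℝ, β (s • v + t • u) • X (s • v + t • u) - α (s • v + t • u) • Y (s • v + t • u)
      = t • (s • B + t • C) := by
    intro s t
    have : t • (s • B + t • C) = (s * s) • (β v • X v - α v • Y v) + t • (s • B + t • C) := by
      rw [hQv]; simp
    rw [this, hB, hC]
    simp only [map_add, map_smul, smul_eq_mul]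
    module
  -- M (s v + t u) = s B + t C
  let cs : ℝ × ℝ →L[ℝ] ℝ := D⁻¹ • (u.2 • ContinuousLinearMap.fst ℝ ℝ ℝ - u.1 • ContinuousLinearMap.snd ℝ ℝ ℝ)
  let ct : ℝ × ℝ →L[ℝ] ℝ := D⁻¹ • (v.1 • ContinuousLinearMap.snd ℝ ℝ ℝ - v.2 • ContinuousLinearMap.fst ℝ ℝ ℝ)
  let M : ℝ × ℝ →L[ℝ] ℝ × ℝ := cs.smulRight B + ct.smulRight C
  have hMst : ∀ s t : ℝ, M (s • v + t • u) = s • B + t • C := by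
    intro s t
    have e1 : cs (s • v + t • u) = s := by
      simp only [cs, smul_apply, sub_apply,
        ContinuousLinearMap.coe_fst', ContinuousLinearMap.coe_snd', Prod.fst_add, Prod.snd_add,
        Prod.smul_fst, Prod.smul_snd, smul_eq_mul]
      rw [inv_mul_eq_iff_eq_mul₀ hd, hD]; ring
    have e2 : ct (s • v + t • u) = t := by
      simp only [ct, smul_apply, sub_apply,
        ContinuousLinearMap.coe_fst', ContinuousLinearMap.coe_snd', Prod.fst_add, Prod.snd_add,
        Prod.smul_fst, Prod.smul_snd, smul_eq_mul]
      rw [inv_mul_eq_iff_eq_mul₀ hd, hD]; ring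
    simp only [M, add_apply, ContinuousLinearMap.smulRight_apply, e1, e2]
  have hM1 : ∀ s t : ℝ, t ≠ 0 → fderiv ℝ (fun u => φ₀ u ^ 2) (s • v + t • u) (M (s • v + t • u)) = 0 := by
    intro s t ht
    have h1 := hQ _ (comb_ne v u hd s t (Or.inr ht))
    rw [hQst, map_smul, smul_eq_mul] at h1
    rw [hMst]
    exact (mul_eq_zero.1 h1).resolve_left ht
  have hM0 : M = 0 := by
    apply L1 h hn
    intro x hx
    obtain ⟨s, t, rfl⟩ := span2 v u x hd
    by_cases ht : t = 0
    · subst ht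
      simp only [zero_smul, add_zero] at hx ⊢
      exact dens h (s • v) u hx M (fun t ht => hM1 s t ht)
    · exact hM1 s t ht
  intro x
  obtain ⟨s, t, rfl⟩ := span2 v u x hd
  have h1 := hQst s t
  rw [← hMst, hM0] at h1
  simpa [sub_eq_zero] using h1

lemma PL {φ₀ : ℝ × ℝ → ℝ} (h : IsBanachMinkowski φ₀) (hn : NowhereEuc φ₀)
    (X Y : ℝ × ℝ →L[ℝ] ℝ × ℝ) (α β : ℝ × ℝ →L[ℝ] ℝ) (k : ℝ × ℝ → ℝ) (u1 u2 : ℝ × ℝ)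
    (hu2 : u2 ≠ 0)
    (hX : ∀ v, v ≠ 0 → fderiv ℝ (fun u => φ₀ u ^ 2) v (X v) + α v * k v = 0)
    (hY : ∀ v, v ≠ 0 → fderiv ℝ (fun u => φ₀ u ^ 2) v (Y v) + β v * k v = 0)
    (h1 : Y u1 + u2 = X u2) (h2 : β u1 = α u2) :
    ∃ c : ℝ, X = -(c • Y) ∧ α = -(c • β) := by
  have hQ : ∀ v, β v • X v = α v • Y v := by
    apply L2 h hn
    intro v hv
    rw [map_sub, map_smul, map_smul, smul_eq_mul, smul_eq_mul]
    linear_combination β v * hX v hv - α v * hY v hv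
  have hlin : ∀ a b : ℝ, a • α + b • β = 0 → a • X + b • Y = 0 := by
    intro a b hab
    apply L1 h hn
    intro v hv
    have := DFunLike.congr_fun hab v
    simp only [add_apply, smul_apply, map_add, map_smul,
      smul_eq_mul, zero_apply] at this ⊢
    linear_combination a * hX v hv + b * hY v hv - k v * this
  by_cases hdep : α (1,0) * β (0,1) - α (0,1) * β (1,0) = 0
  · by_cases hb : β = 0
    · exfalso
      have hY0 : Y = 0 := by simpa using hlin 0 1 (by simp [hb])
      rw [hb] at h2
      rw [hY0] at h1
      simp at h1 h2
      have h3 := hX u2 hu2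
      rw [← h1, ← h2, BM.euler h hu2] at h3
      have := BM.sqpos h hu2
      linarith
    · have hex : ∃ c : ℝ, α + c • β = 0 := by
        have hb' : ((β (1,0), β (0,1)) : ℝ × ℝ) ≠ 0 := by
          intro h0
          apply hb
          have h1 := congrArg Prod.fst h0
          have h2 := congrArg Prod.snd h0
          simp only [Prod.fst_zero, Prod.snd_zero] at h1 h2
          ext <;> simp [h1, h2]
        obtain ⟨μ, hμ⟩ := par (β (1,0), β (0,1)) (α (1,0), α (0,1)) hb' (by simp only; linarith)
        have h1 := congrArg Prod.fst hμ
        have h2 := congrArg Prod.snd hμ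
        simp at h1 h2
        exact ⟨-μ, by ext <;> simp [h1, h2]⟩
      obtain ⟨c, hc⟩ := hex
      refine ⟨c, ?_, ?_⟩
      · have := hlin 1 c (by simpa using hc)
        rw [one_smul] at this
        exact eq_neg_of_add_eq_zero_left this
      · exact eq_neg_of_add_eq_zero_left hc
  · exfalso
    set Δ := α (1,0) * β (0,1) - α (0,1) * β (1,0) with hΔ
    have hval : ∀ (γ : ℝ × ℝ →L[ℝ] ℝ) (v : ℝ × ℝ), γ v = v.1 * γ (1,0) + v.2 * γ (0,1) := by
      intro γ v
      have : v = v.1 • ((1,0) : ℝ × ℝ) + v.2 • ((0,1) : ℝ × ℝ) := by ext <;> simp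
      conv_lhs => rw [this]
      rw [map_add, map_smul, map_smul]; simp
    set v1 : ℝ × ℝ := (β (0,1) / Δ, - β (1,0) / Δ) with hv1
    set v2 : ℝ × ℝ := (- α (0,1) / Δ, α (1,0) / Δ) with hv2
    have a1 : α v1 = 1 := by rw [hval, hv1]; simp only; field_simp; rw [hΔ]; ring
    have b1 : β v1 = 0 := by rw [hval, hv1]; simp only; field_simp; ring
    have a2 : α v2 = 0 := by rw [hval, hv2]; simp only; field_simp; ring
    have b2 : β v2 = 1 := by rw [hval, hv2]; simp only; field_simp; rw [hΔ]; ring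
    have hs : ∀ x : ℝ × ℝ, x = α x • v1 + β x • v2 := by
      intro x
      rw [hval α x, hval β x, hv1, hv2]
      ext
      · simp only [Prod.fst_add, Prod.smul_fst, smul_eq_mul]; field_simp; rw [hΔ]; ring
      · simp only [Prod.snd_add, Prod.smul_snd, smul_eq_mul]; field_simp; rw [hΔ]; ring
    have q1 : Y v1 = 0 := by have := hQ v1; rw [a1, b1] at this; simpa using this.symm
    have q2 : X v2 = 0 := by have := hQ v2; rw [a2, b2] at this; simpa using this
    have q3 : X v1 = Y v2 := by
      have := hQ (v1 + v2)
      simpa [a1, a2, b1, b2, q1, q2] using this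
    apply hu2
    have e1 : X u2 = α u2 • X v1 := by
      conv_lhs => rw [hs u2]
      simp [q2]
    have e2 : Y u1 = β u1 • X v1 := by
      conv_lhs => rw [hs u1]
      simp [q1, q3]
    rw [e1, e2, h2] at h1
    simpa using h1

def uu1 (y : ℝ) : ℝ × ℝ := (Real.cos y, Real.sin y)
def uu2 (y : ℝ) : ℝ × ℝ := (-Real.sin y, Real.cos y)

lemma uu1_deriv (y : ℝ) : HasDerivAt uu1 (uu2 y) y :=
  (Real.hasDerivAt_cos y).prodMk (Real.hasDerivAt_sin y)

lemma uu2_deriv (y : ℝ) : HasDerivAt uu2 (-uu1 y) y := by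
  have := (Real.hasDerivAt_sin y).neg.prodMk (Real.hasDerivAt_cos y)
  exact this

lemma snd_comp {F : Type*} [NormedAddCommGroup F] [NormedSpace ℝ F] {u : ℝ → F} {u' : F}
    (p : ℝ × ℝ) (hu : HasDerivAt u u' p.2) :
    HasFDerivAt (fun q : ℝ × ℝ => u q.2) ((ContinuousLinearMap.snd ℝ ℝ ℝ).smulRight u') p := by
  have h1 : HasFDerivAt (fun q : ℝ × ℝ => q.2) (ContinuousLinearMap.snd ℝ ℝ ℝ) p := hasFDerivAt_snd
  have h2 : HasFDerivAt (fun q : ℝ × ℝ => u q.2) _ p :=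
    HasFDerivAt.comp (f := fun q : ℝ × ℝ => q.2) p hu.hasFDerivAt h1
  refine h2.congr_fderiv ?_
  ext <;> simp

lemma uu_det (y : ℝ) : (uu1 y).1 * (uu2 y).2 - (uu1 y).2 * (uu2 y).1 ≠ 0 := by
  have := Real.sin_sq_add_cos_sq y
  simp only [uu1, uu2]
  intro h
  nlinarith

lemma uu1_ne (y : ℝ) : uu1 y ≠ 0 := by
  simpa using comb_ne _ _ (uu_det y) 1 0 (by simp)
lemma uu2_ne (y : ℝ) : uu2 y ≠ 0 := by
  simpa using comb_ne _ _ (uu_det y) 0 1 (by simp)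

lemma roundL {φ₀ : ℝ × ℝ → ℝ} (h : IsBanachMinkowski φ₀) (hn : NowhereEuc φ₀) (y0 : ℝ)
    (hy : ∀ᶠ y in nhds y0, fderiv ℝ (fun u => φ₀ u ^ 2) (uu1 y) (uu2 y) = 0) : False := by
  obtain ⟨ε, hε, hb⟩ := Metric.eventually_nhds_iff_ball.1 hy
  have hder : ∀ y, HasDerivAt (fun y => φ₀ (uu1 y) ^ 2)
      (fderiv ℝ (fun u => φ₀ u ^ 2) (uu1 y) (uu2 y)) y := fun y =>
    (BM.diff h (uu1_ne y)).comp_hasDerivAt y (uu1_deriv y)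
  have hconst : ∀ y ∈ Metric.ball y0 ε, φ₀ (uu1 y) ^ 2 = φ₀ (uu1 y0) ^ 2 := by
    intro y hyb
    refine Metric.isOpen_ball.is_const_of_deriv_eq_zero (convex_ball y0 ε).isPreconnected
      (fun y _ => (hder y).differentiableAt.differentiableWithinAt)
      (fun y hy => ?_) hyb (Metric.mem_ball_self hε)
    rw [(hder y).deriv]
    exact hb y hy
  let pc : ℝ × ℝ → ℝ × ℝ := fun q => q.1 • uu1 q.2
  have hpc : ContDiff ℝ 1 pc := by
    unfold pc uu1; fun_prop
  let L : ℝ × ℝ →L[ℝ] ℝ × ℝ := (ContinuousLinearMap.fst ℝ ℝ ℝ).smulRight (uu1 y0)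
    + (ContinuousLinearMap.snd ℝ ℝ ℝ).smulRight (uu2 y0)
  have hL : HasFDerivAt pc L (1, y0) := by
    have h1 : HasFDerivAt (fun q : ℝ × ℝ => q.1) (ContinuousLinearMap.fst ℝ ℝ ℝ) (1, y0) := hasFDerivAt_fst
    have h2 : HasFDerivAt (fun q : ℝ × ℝ => uu1 q.2) ((ContinuousLinearMap.snd ℝ ℝ ℝ).smulRight (uu2 y0)) (1, y0) :=
      snd_comp (1, y0) (uu1_deriv y0)
    refine (h1.smul h2).congr_fderiv ?_
    ext <;> simp [L]
  have hs : HasStrictFDerivAt pc L (1, y0) := hpc.contDiffAt.hasStrictFDerivAt' hL (by simp)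
  have hsurj : L.range = ⊤ := by
    rw [LinearMap.range_eq_top]
    intro x
    obtain ⟨s, t, rfl⟩ := span2 _ _ x (uu_det y0)
    exact ⟨(s, t), by simp [L]⟩
  have hmap := hs.map_nhds_eq_of_surj hsurj
  have hS : (Set.Ioi (0:ℝ) ×ˢ Metric.ball y0 ε) ∈ nhds ((1, y0) : ℝ × ℝ) :=
    prod_mem_nhds (Ioi_mem_nhds (by norm_num)) (Metric.ball_mem_nhds _ hε)
  have him : pc '' (Set.Ioi (0:ℝ) ×ˢ Metric.ball y0 ε) ∈ nhds (uu1 y0) := by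
    have := Filter.image_mem_map (m := pc) hS
    rw [hmap] at this
    simpa [pc] using this
  obtain ⟨W, hWs, hWo, hWm⟩ := mem_nhds_iff.1 him
  set κ := φ₀ (uu1 y0) ^ 2 with hκ
  have hκp : 0 < κ := BM.sqpos h (uu1_ne y0)
  obtain ⟨q, hq⟩ := exists_qf κ 0 κ
  refine hn W hWo ⟨_, hWm⟩ ?_ q ?_ ?_
  · intro v hv
    obtain ⟨⟨r, y⟩, ⟨hr, hy⟩, rfl⟩ := hWs hv
    exact smul_ne_zero (ne_of_gt hr) (uu1_ne y)
  · intro v hv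
    rw [hq]
    have h1 : 0 < v.1 ^ 2 + v.2 ^ 2 := by
      by_contra h0
      apply hv
      have h1 : v.1 = 0 := by nlinarith [sq_nonneg v.1, sq_nonneg v.2]
      have h2 : v.2 = 0 := by nlinarith [sq_nonneg v.1, sq_nonneg v.2]
      exact Prod.ext h1 h2
    nlinarith
  · intro v hv
    obtain ⟨⟨r, y⟩, ⟨hr, hy⟩, rfl⟩ := hWs hv
    have h1 := BM.hom h (uu1 y) (le_of_lt hr)
    simp only [pc]
    rw [h1, hconst y hy, hq]
    simp only [uu1, Prod.smul_fst, Prod.smul_snd, smul_eq_mul]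
    linear_combination (-κ * r ^ 2) * Real.sin_sq_add_cos_sq y

section emb
variable {V : Type*} [NormedAddCommGroup V] [NormedSpace ℝ V] [FiniteDimensional ℝ V]

lemma pt {φ₀ : ℝ × ℝ → ℝ} (h : IsBanachMinkowski φ₀) (hn : NowhereEuc φ₀)
    (hdim : Module.finrank ℝ V = 3) {Φ : V → ℝ} (hΦ : IsBanachMinkowski Φ)
    (A Ax Ay : ℝ × ℝ →L[ℝ] V) (hA : ∀ v, Φ (A v) = φ₀ v)
    (hx : ∀ v, v ≠ 0 → fderiv ℝ (fun u => Φ u ^ 2) (A v) (Ax v) = 0)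
    (hy : ∀ v, v ≠ 0 → fderiv ℝ (fun u => Φ u ^ 2) (A v) (Ay v) = 0)
    (u1 u2 : ℝ × ℝ) (hu2 : u2 ≠ 0) (hcl : Ay u1 + A u2 = Ax u2) :
    ∃ c : ℝ, Ax = -(c • Ay) ∧ Ay (u1 + c • u2) = -(A u2) ∧ u1 + c • u2 ≠ 0 ∧ A u2 ≠ 0 ∧
      fderiv ℝ (fun u => φ₀ u ^ 2) (u1 + c • u2) u2 = 0 ∧
      ∃ ν : V →L[ℝ] ℝ, (∀ v, ν (A v) = 0) ∧ ν (Ay (u1 + c • u2)) = 0 ∧ ∃ v, ν (Ay v) ≠ 0 := by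
  have hA0 : ∀ v, v ≠ 0 → A v ≠ 0 := by
    intro v hv h0
    have h1 := h.2.1 v hv
    rw [← hA, h0, hΦ.1] at h1
    exact lt_irrefl _ h1
  have hdg : ∀ v, v ≠ 0 → ∀ x, fderiv ℝ (fun u => Φ u ^ 2) (A v) (A x) =
      fderiv ℝ (fun u => φ₀ u ^ 2) v x := by
    intro v hv x
    have h1 : HasFDerivAt (fun u => Φ (A u) ^ 2) ((fderiv ℝ (fun u => Φ u ^ 2) (A v)).comp A) v :=
      (BM.diff hΦ (hA0 v hv)).comp v A.hasFDerivAt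
    simp only [hA] at h1
    rw [h1.fderiv]; rfl
  obtain ⟨n, hnn⟩ : ∃ n : V, n ∉ A.range := by
    by_contra hcon
    push Not at hcon
    have h1 : A.range = ⊤ := by ext; simp [hcon]
    have h2 := LinearMap.finrank_range_le (A : ℝ × ℝ →ₗ[ℝ] V)
    rw [h1, finrank_top, hdim] at h2
    simp at h2
  let T : (ℝ × ℝ) × ℝ →ₗ[ℝ] V := (A : ℝ × ℝ →ₗ[ℝ] V).coprod (LinearMap.toSpanSingleton ℝ V n)
  have hT : ∀ q t, T (q, t) = A q + t • n := by intro q t; simp [T]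
  have hTi : Function.Injective T := by
    rw [← LinearMap.ker_eq_bot, LinearMap.ker_eq_bot']
    rintro ⟨q, t⟩ h0
    rw [hT] at h0
    have ht : t = 0 := by
      by_contra ht
      apply hnn
      refine ⟨-(t⁻¹ • q), ?_⟩
      have : A q = -(t • n) := eq_neg_of_add_eq_zero_left h0
      simp [this, ht]
    subst ht
    have hq : q = 0 := by
      by_contra hq
      exact hA0 q hq (by simpa using h0)
    simp [hq]
  let E : ((ℝ × ℝ) × ℝ) ≃L[ℝ] V := (T.linearEquivOfInjective hTi (by simp [hdim])).toContinuousLinearEquiv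
  have hE : ∀ q t, E (q, t) = A q + t • n := hT
  let π₁ : V →L[ℝ] ℝ × ℝ := (ContinuousLinearMap.fst ℝ (ℝ × ℝ) ℝ).comp (E.symm : V →L[ℝ] (ℝ × ℝ) × ℝ)
  let ν : V →L[ℝ] ℝ := (ContinuousLinearMap.snd ℝ (ℝ × ℝ) ℝ).comp (E.symm : V →L[ℝ] (ℝ × ℝ) × ℝ)
  have hdec : ∀ z, z = A (π₁ z) + ν z • n := by
    intro z
    rw [← hE]
    simp [π₁, ν]
  have hAE : ∀ v, A v = E (v, 0) := by intro v; simp [hE]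
  have hπA : ∀ v, π₁ (A v) = v := by intro v; rw [hAE]; simp [π₁]
  have hνA : ∀ v, ν (A v) = 0 := by intro v; rw [hAE]; simp [ν]
  let k : ℝ × ℝ → ℝ := fun v => fderiv ℝ (fun u => Φ u ^ 2) (A v) n
  have hB : ∀ B : ℝ × ℝ →L[ℝ] V, (∀ v, v ≠ 0 → fderiv ℝ (fun u => Φ u ^ 2) (A v) (B v) = 0) →
      ∀ v, v ≠ 0 → fderiv ℝ (fun u => φ₀ u ^ 2) v ((π₁.comp B) v) + (ν.comp B) v * k v = 0 := by
    intro B hB v hv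
    have h1 := hB v hv
    rw [hdec (B v), map_add, hdg v hv, map_smul] at h1
    exact h1
  have hX := hB Ax hx
  have hY := hB Ay hy
  have c1 : (π₁.comp Ay) u1 + u2 = (π₁.comp Ax) u2 := by
    have := congrArg π₁ hcl
    rwa [map_add, hπA] at this
  have c2 : (ν.comp Ay) u1 = (ν.comp Ax) u2 := by
    have := congrArg ν hcl
    rwa [map_add, hνA, add_zero] at this
  obtain ⟨c, e1, e2⟩ := PL h hn _ _ _ _ k u1 u2 hu2 hX hY c1 c2
  have hAx : Ax = -(c • Ay) := by
    refine ContinuousLinearMap.ext fun v => ?_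
    have f1 : π₁ (Ax v) = -(c • π₁ (Ay v)) := DFunLike.congr_fun e1 v
    have f2 : ν (Ax v) = -(c • ν (Ay v)) := DFunLike.congr_fun e2 v
    rw [hdec (Ax v), f1, f2]
    change _ = -(c • Ay v)
    conv_rhs => rw [hdec (Ay v)]
    simp only [map_neg, map_smul, smul_eq_mul]
    module
  have hw : Ay (u1 + c • u2) = -(A u2) := by
    have f : Ax u2 = -(c • Ay u2) := DFunLike.congr_fun hAx u2
    rw [f] at hcl
    rw [map_add, map_smul]
    rw [eq_neg_iff_add_eq_zero]
    calc _ = (Ay u1 + A u2) + c • Ay u2 := by abel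
      _ = 0 := by rw [hcl]; simp
  have hw0 : u1 + c • u2 ≠ 0 := by
    intro h0
    rw [h0, map_zero] at hw
    exact hA0 u2 hu2 (neg_eq_zero.1 hw.symm)
  refine ⟨c, hAx, hw, hw0, hA0 u2 hu2, ?_, ν, hνA, ?_, ?_⟩
  · have := hy _ hw0
    rw [hw, map_neg, hdg _ hw0] at this
    simpa using this
  · rw [hw, map_neg, hνA, neg_zero]
  · by_contra hcon
    push Not at hcon
    have : π₁.comp Ay = 0 := by
      apply L1 h hn
      intro v hv
      have h1 := hY v hv
      have h2 : (ν.comp Ay) v = 0 := hcon v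
      rwa [h2, zero_mul, add_zero] at h1
    have h1 : π₁ (Ay (u1 + c • u2)) = 0 := DFunLike.congr_fun this _
    rw [hw, map_neg, hπA] at h1
    exact hu2 (neg_eq_zero.1 h1)

end emb

section emb2
variable {V : Type*} [NormedAddCommGroup V] [NormedSpace ℝ V] [FiniteDimensional ℝ V]

lemma two_le_ms : minSmoothness ℝ 2 ≤ ((⊤ : ℕ∞) : WithTop ℕ∞) := by
  rw [minSmoothness_of_isRCLikeNormedField]
  exact WithTop.coe_le_coe.2 le_top

lemma along {E F : Type*} [NormedAddCommGroup E] [NormedSpace ℝ E] [NormedAddCommGroup F]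
    [NormedSpace ℝ F] {f : E → F} {f' : E →L[ℝ] F} {p : E} (hf : HasFDerivAt f f' p) (e : E) :
    HasDerivAt (fun s : ℝ => f (p + s • e)) (f' e) 0 := by
  have hc : HasDerivAt (fun t : ℝ => p + t • e) e 0 := by
    simpa using ((hasDerivAt_id (0:ℝ)).smul_const e).const_add p
  exact (show HasFDerivAt f f' (p + (0:ℝ) • e) by simpa using hf).comp_hasDerivAt (0:ℝ) hc

lemma core {φ₀ : ℝ × ℝ → ℝ} (h : IsBanachMinkowski φ₀) (hn : NowhereEuc φ₀)
    (hdim : Module.finrank ℝ V = 3) {Φ : V → ℝ} (hΦ : IsBanachMinkowski Φ)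
    (U : Set (ℝ × ℝ)) (hU : IsOpen U) (A : ℝ × ℝ → (ℝ × ℝ →L[ℝ] V))
    (hAs : ContDiffOn ℝ (⊤ : ℕ∞) A U) (hA : ∀ p ∈ U, ∀ v, Φ (A p v) = φ₀ v)
    (hcl : ∀ p ∈ U, fderiv ℝ A p (0,1) (uu1 p.2) + A p (uu2 p.2) = fderiv ℝ A p (1,0) (uu2 p.2))
    (p0 : ℝ × ℝ) (hp0 : p0 ∈ U) :
    fderiv ℝ (fun u => φ₀ u ^ 2) (uu1 p0.2) (uu2 p0.2) = 0 := by
  have hAat : ∀ p ∈ U, ContDiffAt ℝ (⊤ : ℕ∞) A p := fun p hp => hAs.contDiffAt (hU.mem_nhds hp)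
  have hAd : ∀ p ∈ U, HasFDerivAt A (fderiv ℝ A p) p := fun p hp =>
    ((hAat p hp).differentiableAt (by simp)).hasFDerivAt
  have hA0 : ∀ p ∈ U, ∀ v, v ≠ 0 → A p v ≠ 0 := by
    intro p hp v hv h0
    have h1 := h.2.1 v hv
    rw [← hA p hp, h0, hΦ.1] at h1
    exact lt_irrefl _ h1
  have htan : ∀ p ∈ U, ∀ e v, v ≠ 0 →
      fderiv ℝ (fun u => Φ u ^ 2) (A p v) (fderiv ℝ A p e v) = 0 := by
    intro p hp e v hv
    have h1 : HasFDerivAt (fun q => A q v) ((fderiv ℝ A p).flip v) p := by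
      have := (hAd p hp).clm_apply (hasFDerivAt_const v p)
      simpa using this
    have h2 : HasFDerivAt (fun q => Φ (A q v) ^ 2)
      ((fderiv ℝ (fun u => Φ u ^ 2) (A p v)).comp ((fderiv ℝ A p).flip v)) p :=
      HasFDerivAt.comp (f := fun q => A q v) (g := fun u => Φ u ^ 2) p (BM.diff hΦ (hA0 p hp v hv)) h1
    have h3 : HasFDerivAt (fun q => Φ (A q v) ^ 2) (0 : ℝ × ℝ →L[ℝ] ℝ) p := by
      refine (hasFDerivAt_const (φ₀ v ^ 2) p).congr_of_eventuallyEq ?_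
      filter_upwards [hU.mem_nhds hp] with q hq
      rw [hA q hq]
    exact DFunLike.congr_fun (h2.unique h3) e
  have hpt := fun p hp => pt h hn hdim hΦ (A p) (fderiv ℝ A p (1,0)) (fderiv ℝ A p (0,1)) (hA p hp)
    (htan p hp (1,0)) (htan p hp (0,1)) (uu1 p.2) (uu2 p.2) (uu2_ne p.2) (hcl p hp)
  have hD2 : HasFDerivAt (fderiv ℝ A) (fderiv ℝ (fderiv ℝ A) p0) p0 :=
    (((hAat p0 hp0).fderiv_right (m := (⊤ : ℕ∞)) le_rfl).differentiableAt
      (by simp)).hasFDerivAt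
  have hsymm : fderiv ℝ (fderiv ℝ A) p0 (1,0) (0,1) = fderiv ℝ (fderiv ℝ A) p0 (0,1) (1,0) :=
    ((hAat p0 hp0).isSymmSndFDerivAt two_le_ms) _ _
  obtain ⟨c0, hc1, hc2, hc3, hc4, hc5, ν, hν1, hν2, hν3⟩ := hpt p0 hp0
  set y0 := p0.2 with hy0
  set w0 := uu1 y0 + c0 • uu2 y0 with hw0
  obtain ⟨l, hl⟩ : ∃ l : V →L[ℝ] ℝ, l (fderiv ℝ A p0 (0,1) w0) ≠ 0 := by
    apply SeparatingDual.exists_ne_zero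
    rw [hc2]; exact neg_ne_zero.2 hc4
  let den : ℝ × ℝ → ℝ := fun p => l (fderiv ℝ A p (0,1) w0)
  let num : ℝ × ℝ → ℝ := fun p => l (fderiv ℝ A p (1,0) w0)
  have hev : ∀ e : ℝ × ℝ, DifferentiableAt ℝ (fun p => l (fderiv ℝ A p e w0)) p0 := by
    intro e
    have h1 := hD2.differentiableAt
    fun_prop
  have hden : DifferentiableAt ℝ den p0 := hev _
  have hnum : DifferentiableAt ℝ num p0 := hev _
  let c : ℝ × ℝ → ℝ := fun p => -(num p * (den p)⁻¹)
  have hcd : HasFDerivAt c (fderiv ℝ c p0) p0 := by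
    have h1 : HasFDerivAt (fun p => (den p)⁻¹) _ p0 :=
      (hasDerivAt_inv (show den p0 ≠ 0 from hl)).comp_hasFDerivAt p0 hden.hasFDerivAt
    have h2 := (hnum.hasFDerivAt.fun_mul h1).fun_neg
    exact h2.differentiableAt.hasFDerivAt
  have hcc : ∀ p a, den p ≠ 0 → fderiv ℝ A p (1,0) = -(a • fderiv ℝ A p (0,1)) → c p = a := by
    intro p a hp ha
    have : num p = -(a * den p) := by
      simp only [num, den, ha]
      simp
    simp only [c, this]
    field_simp
  have hc0 : c p0 = c0 := hcc p0 c0 hl hc1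
  have hnear : ∀ᶠ p in nhds p0, p ∈ U ∧ den p ≠ 0 :=
    (hU.eventually_mem hp0).and (hden.continuousAt.eventually_ne hl)
  have hprop : ∀ᶠ p in nhds p0,
      fderiv ℝ A p (1,0) = -(c p • fderiv ℝ A p (0,1)) ∧
      fderiv ℝ A p (0,1) (uu1 p.2 + c p • uu2 p.2) = -(A p (uu2 p.2)) ∧
      fderiv ℝ (fun u => φ₀ u ^ 2) (uu1 p.2 + c p • uu2 p.2) (uu2 p.2) = 0 := by
    filter_upwards [hnear] with p ⟨hp, hd⟩
    obtain ⟨a, h1, h2, h3, h4, h5, -⟩ := hpt p hp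
    have := hcc p a hd h1
    rw [this]
    exact ⟨h1, h2, h5⟩
  -- derivative along `e`
  have hder : ∀ e : ℝ × ℝ,
      (fderiv ℝ (fderiv ℝ A) p0 e (1,0) = -(c0 • fderiv ℝ (fderiv ℝ A) p0 e (0,1) +
        (fderiv ℝ c p0 e) • fderiv ℝ A p0 (0,1))) ∧
      (fderiv ℝ (fderiv ℝ A) p0 e (0,1) w0 + fderiv ℝ A p0 (0,1)
        (e.2 • uu2 y0 + (c0 • (e.2 • -uu1 y0) + (fderiv ℝ c p0 e) • uu2 y0)) =
          -(fderiv ℝ A p0 e (uu2 y0) + A p0 (e.2 • -uu1 y0))) ∧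
      (fderiv ℝ (fderiv ℝ (fun u => φ₀ u ^ 2)) w0
        (e.2 • uu2 y0 + (c0 • (e.2 • -uu1 y0) + (fderiv ℝ c p0 e) • uu2 y0)) (uu2 y0) +
        fderiv ℝ (fun u => φ₀ u ^ 2) w0 (e.2 • -uu1 y0) = 0) := by
    intro e
    have tend : Filter.Tendsto (fun s : ℝ => p0 + s • e) (nhds 0) (nhds p0) := by
      have : Continuous (fun s : ℝ => p0 + s • e) := by fun_prop
      simpa using this.tendsto 0
    have hev := tend.eventually hprop
    have d1 : HasDerivAt (fun s : ℝ => uu1 (p0 + s • e).2) (e.2 • uu2 y0) 0 := by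
      have : HasFDerivAt (fun q : ℝ × ℝ => uu1 q.2) ((ContinuousLinearMap.snd ℝ ℝ ℝ).smulRight (uu2 y0)) p0 :=
        snd_comp p0 (uu1_deriv y0)
      simpa using along this e
    have d2 : HasDerivAt (fun s : ℝ => uu2 (p0 + s • e).2) (e.2 • -uu1 y0) 0 := by
      have : HasFDerivAt (fun q : ℝ × ℝ => uu2 q.2) ((ContinuousLinearMap.snd ℝ ℝ ℝ).smulRight (-uu1 y0)) p0 :=
        snd_comp p0 (uu2_deriv y0)
      simpa using along this e
    have dc := along hcd e
    have dA := along (hAd p0 hp0) e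
    have dD := along (E := ℝ × ℝ) (F := ℝ × ℝ →L[ℝ] (ℝ × ℝ →L[ℝ] V)) (f := fderiv ℝ A) (f' := fderiv ℝ (fderiv ℝ A) p0) (p := p0) hD2 e
    have dD' : ∀ e', HasDerivAt (fun s : ℝ => fderiv ℝ A (p0 + s • e) e')
        (fderiv ℝ (fderiv ℝ A) p0 e e') 0 := by
      intro e'
      simpa using dD.clm_apply (hasDerivAt_const (0:ℝ) e')
    have dw := d1.fun_add (dc.fun_smul d2)
    simp only [zero_smul, add_zero, hc0, ← hy0] at dw
    refine ⟨?_, ?_, ?_⟩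
    · have r := (dc.fun_smul (dD' (0,1))).fun_neg
      simp only [zero_smul, add_zero, hc0] at r
      refine (dD' (1,0)).unique (r.congr_of_eventuallyEq ?_)
      filter_upwards [hev] with s hs
      exact hs.1
    · have l := (dD' (0,1)).clm_apply dw
      have r := (dA.clm_apply d2).fun_neg
      simp only [zero_smul, add_zero, hc0, ← hy0, ← hw0] at l r
      refine l.unique (r.congr_of_eventuallyEq ?_)
      filter_upwards [hev] with s hs
      exact hs.2.1
    · have k : HasDerivAt (fun s : ℝ => fderiv ℝ (fun u => φ₀ u ^ 2)
        (uu1 (p0 + s • e).2 + c (p0 + s • e) • uu2 (p0 + s • e).2))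
        (fderiv ℝ (fderiv ℝ (fun u => φ₀ u ^ 2)) w0
        (e.2 • uu2 y0 + (c0 • (e.2 • -uu1 y0) + (fderiv ℝ c p0 e) • uu2 y0))) 0 := by
        refine HasFDerivAt.comp_hasDerivAt (0:ℝ) (f := fun s : ℝ =>
          (uu1 (p0 + s • e).2 + c (p0 + s • e) • uu2 (p0 + s • e).2)) ?_ dw
        simp only [zero_smul, add_zero, hc0, ← hy0, ← hw0]
        exact BM.diff2 h hc3
      have l := k.clm_apply d2
      simp only [zero_smul, add_zero, hc0, ← hy0, ← hw0] at l
      refine l.unique ((hasDerivAt_const (0:ℝ) (0:ℝ)).congr_of_eventuallyEq ?_)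
      filter_upwards [hev] with s hs
      exact hs.2.2
  obtain ⟨-, x2, x3⟩ := hder (1,0)
  obtain ⟨z1, z2, z3⟩ := hder (0,1)
  simp only [zero_smul, smul_zero, zero_add, one_smul, map_zero, add_zero] at x2 x3 z2 z3
  -- c_x = 0
  have hcx : fderiv ℝ c p0 (1,0) = 0 := by
    have hp := BM.posdef h hc3 (uu2_ne y0)
    simp only [map_smul, smul_apply, smul_eq_mul] at x3
    exact (mul_eq_zero.1 x3).resolve_right hp.ne'
  set cy := fderiv ℝ c p0 (0,1) with hcy
  set w' := uu2 y0 + (c0 • -uu1 y0 + cy • uu2 y0) with hw'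
  -- w, w' independent
  have hind : w0.1 * w'.2 - w0.2 * w'.1 ≠ 0 := by
    intro h0
    obtain ⟨μ, hμ⟩ := par w0 w' hc3 h0
    rw [hμ] at z3
    simp only [map_smul, smul_apply, BM.euler2 h hc3, hc5, smul_zero, zero_add, map_neg, neg_eq_zero] at z3
    have h1 := BM.euler h hc3
    have h2 := BM.sqpos h hc3
    have h3 : fderiv ℝ (fun u => φ₀ u ^ 2) w0 w0 = fderiv ℝ (fun u => φ₀ u ^ 2) w0 (uu1 y0)
        + c0 * fderiv ℝ (fun u => φ₀ u ^ 2) w0 (uu2 y0) := by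
      conv_lhs => rw [hw0, map_add, map_smul, ← hw0]
      rfl
    rw [z3, hc5] at h3
    linarith
  have hmain : c0 * ν (fderiv ℝ A p0 (0,1) w') = 0 := by
    rw [hcx, zero_smul, map_zero, add_zero, hsymm, z1, hc1] at x2
    have y2 := congrArg ν x2
    have y3 := congrArg ν z2
    have y4 := congrArg ν hc2
    simp only [neg_apply, add_apply, smul_apply, map_neg, map_add, map_smul, hν1, smul_eq_mul, hν2] at y2 y3 y4 ⊢
    linear_combination c0 * y3 + y2
  have hc00 : c0 = 0 := by
    by_contra hne
    have hz := (mul_eq_zero.1 hmain).resolve_left hne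
    obtain ⟨v, hv⟩ := hν3
    apply hv
    obtain ⟨s, t, rfl⟩ := span2 w0 w' v hind
    simp only [map_add, map_smul, hz, hν2, smul_zero, add_zero]
  rw [hw0, hc00, zero_smul, add_zero] at hc5
  exact hc5

def Km : ℝ × ℝ →L[ℝ] ℝ × ℝ := (ContinuousLinearMap.snd ℝ ℝ ℝ).prod (-ContinuousLinearMap.fst ℝ ℝ ℝ)

def Rm (y : ℝ) : ℝ × ℝ →L[ℝ] ℝ × ℝ := Real.cos y • ContinuousLinearMap.id ℝ (ℝ × ℝ) + Real.sin y • Km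

def Rm' (y : ℝ) : ℝ × ℝ →L[ℝ] ℝ × ℝ := (-Real.sin y) • ContinuousLinearMap.id ℝ (ℝ × ℝ) + Real.cos y • Km

lemma Rm_deriv (y : ℝ) : HasDerivAt Rm (Rm' y) y :=
  ((Real.hasDerivAt_cos y).smul_const (ContinuousLinearMap.id ℝ (ℝ × ℝ))).add
    ((Real.hasDerivAt_sin y).smul_const Km)

lemma Rm_smooth : ContDiff ℝ (⊤ : ℕ∞) Rm := by
  unfold Rm
  exact (Real.contDiff_cos.smul contDiff_const).add (Real.contDiff_sin.smul contDiff_const)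

lemma Rm_apply (y : ℝ) (v : ℝ × ℝ) : Rm y v =
    (v.1 * Real.cos y + v.2 * Real.sin y, -v.1 * Real.sin y + v.2 * Real.cos y) := by
  ext <;> simp [Rm, Km] <;> ring

lemma Rm'_apply (y : ℝ) (v : ℝ × ℝ) : Rm' y v =
    (-v.1 * Real.sin y + v.2 * Real.cos y, -v.1 * Real.cos y - v.2 * Real.sin y) := by
  ext <;> simp [Rm', Km] <;> ring

lemma noemb {φ₀ : ℝ × ℝ → ℝ} (h : IsBanachMinkowski φ₀) (hn : NowhereEuc φ₀)
    (hdim : Module.finrank ℝ V = 3) {Φ : V → ℝ} (hΦ : IsBanachMinkowski Φ)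
    (U : Set (ℝ × ℝ)) (hU : IsOpen U) (hne : U.Nonempty) (f : ℝ × ℝ → V)
    (hf : ContDiffOn ℝ (⊤ : ℕ∞) f U)
    (hiso : ∀ p ∈ U, ∀ v : ℝ × ℝ, Φ (fderiv ℝ f p v) = φ₀ (v.1 * Real.cos p.2 - v.2 * Real.sin p.2,
      v.1 * Real.sin p.2 + v.2 * Real.cos p.2)) : False := by
  let A : ℝ × ℝ → (ℝ × ℝ →L[ℝ] V) := fun p => (fderiv ℝ f p).comp (Rm p.2)
  have hfat : ∀ p ∈ U, ContDiffAt ℝ (⊤ : ℕ∞) f p := fun p hp => hf.contDiffAt (hU.mem_nhds hp)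
  have hdf : ∀ p ∈ U, ContDiffAt ℝ (⊤ : ℕ∞) (fderiv ℝ f) p := fun p hp =>
    (hfat p hp).fderiv_right (m := (⊤ : ℕ∞)) le_rfl
  have hAs : ContDiffOn ℝ (⊤ : ℕ∞) A U := fun p hp =>
    ((hdf p hp).clm_comp (Rm_smooth.comp contDiff_snd).contDiffAt).contDiffWithinAt
  have hA : ∀ p ∈ U, ∀ v, Φ (A p v) = φ₀ v := by
    intro p hp v
    have := hiso p hp (Rm p.2 v)
    simp only [A, ContinuousLinearMap.comp_apply]
    rw [this, Rm_apply]
    congr 1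
    have e := Real.sin_sq_add_cos_sq p.2
    ext
    · simp only; linear_combination v.1 * e
    · simp only; linear_combination v.2 * e
  have hder : ∀ p ∈ U, ∀ e v, fderiv ℝ A p e v =
      fderiv ℝ (fderiv ℝ f) p e (Rm p.2 v) + fderiv ℝ f p (e.2 • Rm' p.2 v) := by
    intro p hp e v
    have h1 : HasFDerivAt (fderiv ℝ f) (fderiv ℝ (fderiv ℝ f) p) p :=
      ((hdf p hp).differentiableAt (by simp)).hasFDerivAt
    have h2 : HasFDerivAt (fun q : ℝ × ℝ => Rm q.2) ((ContinuousLinearMap.snd ℝ ℝ ℝ).smulRight (Rm' p.2)) p :=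
      snd_comp p (Rm_deriv p.2)
    rw [(h1.clm_comp h2).fderiv]
    simp
    abel
  have hcl : ∀ p ∈ U, fderiv ℝ A p (0,1) (uu1 p.2) + A p (uu2 p.2) = fderiv ℝ A p (1,0) (uu2 p.2) := by
    intro p hp
    have e := Real.sin_sq_add_cos_sq p.2
    have r1 : Rm p.2 (uu1 p.2) = (1,0) := by
      rw [Rm_apply]; ext <;> simp only [uu1]
      · linear_combination e
      · ring
    have r2 : Rm p.2 (uu2 p.2) = (0,1) := by
      rw [Rm_apply]; ext <;> simp only [uu2]
      · ring
      · linear_combination e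
    have r3 : Rm' p.2 (uu1 p.2) = -(0,1) := by
      rw [Rm'_apply]; ext <;> simp only [uu1, Prod.neg_mk]
      · ring
      · linear_combination -e
    have hs : fderiv ℝ (fderiv ℝ f) p (1,0) (0,1) = fderiv ℝ (fderiv ℝ f) p (0,1) (1,0) :=
      ((hfat p hp).isSymmSndFDerivAt two_le_ms) _ _
    rw [hder p hp, hder p hp]
    simp only [A, ContinuousLinearMap.comp_apply, r1, r2, r3, hs, one_smul, zero_smul, map_zero, map_neg]
    abel
  have hall := core h hn hdim hΦ U hU A hAs hA hcl
  obtain ⟨p0, hp0⟩ := hne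
  refine roundL h hn p0.2 ?_
  have hc : Continuous (fun y : ℝ => ((p0.1, y) : ℝ × ℝ)) := by fun_prop
  have := (hc.tendsto p0.2).eventually (hU.eventually_mem hp0)
  filter_upwards [this] with y hy
  exact hall _ hy

end emb2

def Re (y : ℝ) : (ℝ × ℝ) ≃L[ℝ] (ℝ × ℝ) :=
  ContinuousLinearEquiv.equivOfInverse (Rm (-y)) (Rm y)
    (fun v => by
      have e := Real.sin_sq_add_cos_sq y
      rw [Rm_apply, Rm_apply, Real.cos_neg, Real.sin_neg]
      ext <;> simp only
      · linear_combination v.1 * e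
      · linear_combination v.2 * e)
    (fun v => by
      have e := Real.sin_sq_add_cos_sq y
      rw [Rm_apply, Rm_apply, Real.cos_neg, Real.sin_neg]
      ext <;> simp only
      · linear_combination v.1 * e
      · linear_combination v.2 * e)

lemma Re_apply (y : ℝ) (v : ℝ × ℝ) : Re y v =
    (v.1 * Real.cos y - v.2 * Real.sin y, v.1 * Real.sin y + v.2 * Real.cos y) := by
  change Rm (-y) v = _
  rw [Rm_apply, Real.cos_neg, Real.sin_neg]
  ext <;> simp only <;> ring

/-- Example and Proposition: a non-embeddable Finsler metric: if `φ₀` is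
a Banach–Minkowski norm on ℝ² that is nowhere locally Euclidean, then the rotated metric
`φ((x,y),(ξ,η)) = φ₀(R^y(ξ,η))` is a Finsler metric on ℝ², and no open subset of
`(ℝ², φ)` admits a smooth isometric embedding into a 3-dimensional Banach–Minkowski
space. -/
theorem statement17 (φ₀ : ℝ × ℝ → ℝ) (hφ₀ : IsBanachMinkowski φ₀)
    (hnowhere : ∀ W : Set (ℝ × ℝ), IsOpen W → W.Nonempty → W ⊆ {(0 : ℝ × ℝ)}ᶜ →
      ∀ q : QuadraticForm ℝ (ℝ × ℝ), q.PosDef → ¬ (∀ v ∈ W, φ₀ v ^ 2 = q v))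
    (φ : ℝ × ℝ → ℝ × ℝ → ℝ)
    (hφdef : ∀ x y ξ η : ℝ, φ (x, y) (ξ, η) =
      φ₀ (ξ * Real.cos y - η * Real.sin y, ξ * Real.sin y + η * Real.cos y))
    (U : Set (ℝ × ℝ)) (hUne : U.Nonempty) (hUopen : IsOpen U)
    (V : Type*) [NormedAddCommGroup V] [NormedSpace ℝ V] [FiniteDimensional ℝ V]
    (hdim : Module.finrank ℝ V = 3)
    (Φ : V → ℝ) (hΦ : IsBanachMinkowski Φ) :
    IsFinslerMetric Set.univ φ ∧
    ¬ ∃ f : ℝ × ℝ → V, ContDiffOn ℝ (⊤ : ℕ∞) f U ∧ Set.InjOn f U ∧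
        ∀ x ∈ U, ∀ v : ℝ × ℝ, Φ (fderiv ℝ f x v) = φ x v := by

  have hφ : ∀ p v, φ p v = φ₀ (Re p.2 v) := by
    rintro ⟨x, y⟩ ⟨ξ, η⟩
    rw [hφdef, Re_apply]
  refine ⟨⟨?_, ?_⟩, ?_⟩
  · have h1 : ContDiff ℝ (⊤ : ℕ∞) (fun q : (ℝ × ℝ) × ℝ × ℝ => Re q.1.2 q.2) := by
      simp only [Re_apply]
      fun_prop
    have h2 := hφ₀.2.2.2.2.1.comp (t := {(0 : ℝ × ℝ)}ᶜ) (s := Set.univ ×ˢ {(0 : ℝ × ℝ)}ᶜ)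
      h1.contDiffOn (fun q hq => by
        have : q.2 ≠ 0 := hq.2
        simpa using this)
    exact h2.congr (fun q _ => hφ q.1 q.2)
  · intro p _
    have := BM.comp_equiv hφ₀ (Re p.2)
    have e : φ p = fun w => φ₀ (Re p.2 w) := funext (hφ p)
    rw [e]; exact this
  · rintro ⟨f, hf, -, hiso⟩
    refine noemb hφ₀ hnowhere hdim hΦ U hUopen hUne f hf (fun p hp v => ?_)
    rw [hiso p hp v, hφ, Re_apply]
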